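/- Let a, b > 0 be real numbers and let Ω := conv{(0,0), (a,0), (0,b)}, so that X_Ω is the ellipsoid E(a,b). Then for every real r ≥ 0, cap_{X_Ω}(r) = #{(m,n) ∈ ℤ≥0 × ℤ≥0 : a·m + b·n ≤ r}; that is, the cap function of E(a,b) equals the lattice-point counting function of the rational triangle with vertices (0,0), (1/a, 0), (0, 1/b). -/

import Mathlib

open scoped BigOperators Pointwise

noncomputable section

/-- Planar cross product `det(v,p) = v₁p₂ − v₂p₁`. -/
def det2 (v p : ℝ × ℝ) : ℝ := v.1 * p.2 - v.2 * p.1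

/-- The `Ω`-length of a vector `v`: `max_{p ∈ Ω} det(v,p)`. -/
def omegaLen (Ω : Set (ℝ × ℝ)) (v : ℝ × ℝ) : ℝ := sSup (det2 v '' Ω)

/-- A (possibly degenerate) compact convex polygon with vertices listed in
clockwise order: a cyclic (period `n`) list of pairwise distinct vertices such
that the polygon (the convex hull of the vertices) lies in the right
half-plane of every directed edge. -/
structure ClockPolygon where
  n : ℕ
  npos : 0 < n
  verts : ℕ → ℝ × ℝ
  periodic : ∀ i, verts (i + n) = verts i
  inj : ∀ i j, i < n → j < n → verts i = verts j → i = j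
  clockwise : ∀ i, ∀ q ∈ convexHull ℝ (Set.range verts),
      det2 (verts (i + 1) - verts i) (q - verts i) ≤ 0

/-- The underlying point set of a polygon. -/
def ClockPolygon.body (P : ClockPolygon) : Set (ℝ × ℝ) :=
  convexHull ℝ (Set.range P.verts)

/-- The `Ω`-perimeter `ℓ_Ω(∂Λ)`: the sum of the `Ω`-lengths of the edge
vectors of `Λ`. -/
def omegaPerim (Ω : Set (ℝ × ℝ)) (P : ClockPolygon) : ℝ :=
  ∑ i ∈ Finset.range P.n, omegaLen Ω (P.verts (i + 1) - P.verts i)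

/-- Lattice points of the plane. -/
def IsLatticePt (p : ℝ × ℝ) : Prop := (∃ m : ℤ, p.1 = m) ∧ (∃ m : ℤ, p.2 = m)

/-- Rational points of the plane. -/
def IsRationalPt (p : ℝ × ℝ) : Prop := (∃ q : ℚ, p.1 = q) ∧ (∃ q : ℚ, p.2 = q)

/-- The number of lattice points in a set. -/
def latticeCount (S : Set (ℝ × ℝ)) : ℕ := {p ∈ S | IsLatticePt p}.ncard

/-- Competitor convex lattice domains: convex hulls of finite nonempty sets of
lattice points in `ℝ≥0²`, containing the origin and closed under taking
coordinate rectangles. -/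
def IsCompetitor (P : ClockPolygon) : Prop :=
  (∀ i, IsLatticePt (P.verts i)) ∧
  (∀ i, 0 ≤ (P.verts i).1 ∧ 0 ≤ (P.verts i).2) ∧
  (((0 : ℝ), (0 : ℝ)) ∈ P.body) ∧
  ∀ q ∈ P.body, Set.Icc (0 : ℝ) q.1 ×ˢ Set.Icc (0 : ℝ) q.2 ⊆ P.body

/-- ECH capacities of `X_Ω`, via Cristofaro-Gardiner's combinatorial formula
(taken as a definition). -/
def echCap (Ω : Set (ℝ × ℝ)) (k : ℕ) : ℝ :=
  sInf { r | ∃ P : ClockPolygon, IsCompetitor P ∧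
      latticeCount P.body = k + 1 ∧ omegaPerim Ω P = r }

/-- The cap function `cap_{X_Ω}(r) = #{k : c_k(X_Ω) ≤ r}`. -/
def capFn (Ω : Set (ℝ × ℝ)) (r : ℝ) : ℕ := {k : ℕ | echCap Ω k ≤ r}.ncard

/-- A convex domain: a convex polygon in `ℝ≥0²` with nonempty interior,
containing the origin and closed under taking coordinate rectangles. -/
structure ConvexDomain where
  P : ClockPolygon
  int_nonempty : (interior P.body).Nonempty
  nonneg : ∀ q ∈ P.body, 0 ≤ q.1 ∧ 0 ≤ q.2
  zero_mem : (((0 : ℝ), (0 : ℝ)) ∈ P.body)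
  rect : ∀ q ∈ P.body, Set.Icc (0 : ℝ) q.1 ×ˢ Set.Icc (0 : ℝ) q.2 ⊆ P.body

def ConvexDomain.body (Ω : ConvexDomain) : Set (ℝ × ℝ) := Ω.P.body

/-- A convex lattice domain: all vertices are lattice points. -/
def ConvexDomain.IsLattice (Ω : ConvexDomain) : Prop :=
  ∀ i, IsLatticePt (Ω.P.verts i)

/-- A rational convex domain: all vertices are rational points. -/
def ConvexDomain.IsRational (Ω : ConvexDomain) : Prop :=
  ∀ i, IsRationalPt (Ω.P.verts i)

/-- `X_Ω` is tightly constrained with lower bound `r₀` if every integer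
`r ≥ r₀` is a value `c_k(X_Ω)`. -/
def TightlyConstrained (Ω : ConvexDomain) (r₀ : ℕ) : Prop :=
  ∀ r : ℕ, r₀ ≤ r → ∃ k : ℕ, echCap Ω.body k = r

/-- Every (nonzero) edge of `Q` is parallel to an edge of `P`. -/
def EdgesParallel (Q P : ClockPolygon) : Prop :=
  ∀ i < Q.n, Q.verts (i + 1) - Q.verts i ≠ 0 →
    ∃ j < P.n, ∃ t : ℝ, t ≠ 0 ∧
      Q.verts (i + 1) - Q.verts i = t • (P.verts (j + 1) - P.verts j)

/-- Euclidean inner product on the plane. -/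
def dot2 (u p : ℝ × ℝ) : ℝ := u.1 * p.1 + u.2 * p.2

/-- The dual-norm value `max_{p ∈ K} u·p` (the support function of `K`). -/
def dualLen (K : Set (ℝ × ℝ)) (u : ℝ × ℝ) : ℝ := sSup (dot2 u '' K)

/-- The pseudonorm length `ℓ'_Ω(∂Λ)` with respect to a translated body `K`. -/
def dualPerim (K : Set (ℝ × ℝ)) (P : ClockPolygon) : ℝ :=
  ∑ i ∈ Finset.range P.n, dualLen K (P.verts (i + 1) - P.verts i)


lemma olen_le (a b : ℝ) (v : ℝ × ℝ) (c : ℝ) (h0 : 0 ≤ c) (h1 : b * v.1 ≤ c) (h2 : -(a * v.2) ≤ c) :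
    ∀ q ∈ convexHull ℝ {((0 : ℝ), (0 : ℝ)), (a, 0), (0, b)}, det2 v q ≤ c := by
  have : convexHull ℝ {((0 : ℝ), (0 : ℝ)), (a, 0), (0, b)} ⊆ {q | det2 v q ≤ c} := by
    apply convexHull_min
    · intro q hq
      simp only [Set.mem_insert_iff, Set.mem_singleton_iff] at hq
      rcases hq with rfl | rfl | rfl <;> simp [det2] <;> nlinarith
    · intro p hp q hq s t hs ht hst
      simp only [Set.mem_ofPred_eq, det2, Prod.fst_add, Prod.snd_add, Prod.smul_fst, Prod.smul_snd, smul_eq_mul] at *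
      have : c = s * c + t * c := by rw [← add_mul, hst, one_mul]
      nlinarith [mul_le_mul_of_nonneg_left hp hs, mul_le_mul_of_nonneg_left hq ht]
  exact this

lemma omegaLen_le (a b : ℝ) (v : ℝ × ℝ) (c : ℝ) (h0 : 0 ≤ c) (h1 : b * v.1 ≤ c) (h2 : -(a * v.2) ≤ c) :
    omegaLen (convexHull ℝ {((0 : ℝ), (0 : ℝ)), (a, 0), (0, b)}) v ≤ c := by
  apply csSup_le
  · exact Set.Nonempty.image _ ⟨(0,0), subset_convexHull _ _ (by simp)⟩
  · rintro _ ⟨q, hq, rfl⟩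
    exact olen_le a b v c h0 h1 h2 q hq

lemma le_omegaLen (a b : ℝ) (v q : ℝ × ℝ) (hq : q ∈ ({((0 : ℝ), (0 : ℝ)), (a, 0), (0, b)} : Set (ℝ × ℝ))) :
    det2 v q ≤ omegaLen (convexHull ℝ {((0 : ℝ), (0 : ℝ)), (a, 0), (0, b)}) v := by
  apply le_csSup
  · refine ⟨max 0 (max (b * v.1) (-(a * v.2))), ?_⟩
    rintro _ ⟨q, hq, rfl⟩
    exact olen_le a b v _ (by simp) (by simp) (by simp) q hq
  · exact ⟨q, subset_convexHull _ _ hq, rfl⟩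

lemma periodic_mul (P : ClockPolygon) (i t : ℕ) : P.verts (i + P.n * t) = P.verts i := by
  induction t with
  | zero => simp
  | succ t ih => rw [Nat.mul_succ, ← add_assoc, P.periodic, ih]

lemma sum_shift (n : ℕ) (c : ℕ → ℝ) (hc : ∀ i, c (i + n) = c i) (k : ℕ) :
    ∑ i ∈ Finset.range n, c (k + i) = ∑ i ∈ Finset.range n, c i := by
  induction k with
  | zero => simp
  | succ k ih =>
    rw [← ih]
    have h1 := Finset.sum_range_succ (fun i => c (k + i)) n
    have h2 := Finset.sum_range_succ' (fun i => c (k + i)) n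
    rw [h1] at h2
    simp only [hc, add_zero] at h2
    have : ∀ i, c (k + 1 + i) = c (k + (i + 1)) := fun i => by congr 1; ring
    simp only [this]
    linarith

lemma lower (a b : ℝ) (P : ClockPolygon) (hP : IsCompetitor P) :
    ∀ q ∈ P.body, b * q.1 + a * q.2 ≤
      omegaPerim (convexHull ℝ {((0 : ℝ), (0 : ℝ)), (a, 0), (0, b)}) P := by
  obtain ⟨-, hnn, h0, -⟩ := hP
  have hz : ∃ i, P.verts i = (0, 0) := by
    by_contra! hne
    have : P.body ⊆ {q | 0 < q.1 + q.2} := by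
      apply convexHull_min
      · rintro _ ⟨i, rfl⟩
        have h1 := hnn i
        have h2 := hne i
        simp only [Set.mem_ofPred_eq]
        by_contra! h
        exact h2 (Prod.ext (by simp; linarith) (by simp; linarith))
      · intro p hp q hq s t hs ht hst
        simp only [Set.mem_ofPred_eq, Prod.fst_add, Prod.snd_add, Prod.smul_fst, Prod.smul_snd, smul_eq_mul] at *
        rcases hs.eq_or_lt with rfl | hs
        · have : t = 1 := by linarith
          subst this; linarith
        · nlinarith [mul_pos hs hp, mul_nonneg ht hq.le]
    have := this h0
    simp at this
  obtain ⟨i0, hi0⟩ := hz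
  set Ω := convexHull ℝ {((0 : ℝ), (0 : ℝ)), (a, 0), (0, b)} with hΩ
  set c : ℕ → ℝ := fun i => omegaLen Ω (P.verts (i + 1) - P.verts i) with hc
  have hcp : ∀ i, c (i + P.n) = c i := by
    intro i
    have : i + P.n + 1 = (i + 1) + P.n := by ring
    simp only [hc, this, P.periodic]
  have hx : ∀ i d, b * ((P.verts (i + d)).1 - (P.verts i).1) ≤ ∑ l ∈ Finset.range d, c (i + l) := by
    intro i d
    induction d with
    | zero => simp
    | succ d ih =>
      rw [Finset.sum_range_succ]
      have := le_omegaLen a b (P.verts (i + d + 1) - P.verts (i + d)) (0, b) (by simp)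
      simp only [det2, Prod.fst_sub, Prod.snd_sub] at this
      simp only [hc, ← add_assoc] at *
      linarith
  have hy : ∀ i d, a * ((P.verts i).2 - (P.verts (i + d)).2) ≤ ∑ l ∈ Finset.range d, c (i + l) := by
    intro i d
    induction d with
    | zero => simp
    | succ d ih =>
      rw [Finset.sum_range_succ]
      have := le_omegaLen a b (P.verts (i + d + 1) - P.verts (i + d)) (a, 0) (by simp)
      simp only [det2, Prod.fst_sub, Prod.snd_sub] at this
      simp only [hc, ← add_assoc] at *
      linarith
  have hv : ∀ j, b * (P.verts j).1 + a * (P.verts j).2 ≤ omegaPerim Ω P := by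
    intro j
    have hn := P.npos
    obtain ⟨e, he⟩ : ∃ e, j + P.n * i0 = i0 + e := Nat.exists_eq_add_of_le (by nlinarith)
    have hd : e % P.n < P.n := Nat.mod_lt _ hn
    have hvj : P.verts (i0 + e % P.n) = P.verts j := by
      rw [← periodic_mul P j i0, he, ← periodic_mul P _ (e / P.n), add_assoc, Nat.mod_add_div]
    obtain ⟨f, hf⟩ := Nat.exists_eq_add_of_lt hd
    generalize e % P.n = d at *
    have e1 : omegaPerim Ω P = ∑ i ∈ Finset.range P.n, c (i0 + i) := (sum_shift _ c hcp i0).symm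
    have e2 : ∑ i ∈ Finset.range P.n, c (i0 + i) = ∑ i ∈ Finset.range (d + (f + 1)), c (i0 + i) := by
      rw [hf, add_assoc]
    rw [e1, e2, Finset.sum_range_add]
    have h1 := hx i0 d
    have h2 := hy (i0 + d) (f + 1)
    have h3 : i0 + d + (f + 1) = i0 + P.n := by omega
    rw [h3, P.periodic, hvj, hi0] at h2
    rw [hvj, hi0] at h1
    simp only [add_assoc] at *
    simp at h1 h2
    linarith
  have : P.body ⊆ {q | b * q.1 + a * q.2 ≤ omegaPerim Ω P} := by
    apply convexHull_min
    · rintro _ ⟨i, rfl⟩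
      exact hv i
    · intro p hp q hq s t hs ht hst
      simp only [Set.mem_ofPred_eq, Prod.fst_add, Prod.snd_add, Prod.smul_fst, Prod.smul_snd, smul_eq_mul] at *
      set c := omegaPerim Ω P
      have : c = s * c + t * c := by rw [← add_mul, hst, one_mul]
      nlinarith [mul_le_mul_of_nonneg_left hp hs, mul_le_mul_of_nonneg_left hq ht]
  exact this

def ecost (a b : ℝ) (v w : ℝ × ℝ) : ℝ := max (b * (w.1 - v.1)) (a * (v.2 - w.2))

lemma conv_fill (C : Set (ℝ × ℝ)) (hC : Convex ℝ C) (h0 : ((0 : ℝ), (0 : ℝ)) ∈ C) (W : ℝ)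
    (hW : (W, (0 : ℝ)) ∈ C) (x t y : ℝ) (hx : 0 ≤ x) (hxW : x ≤ W) (ht : (x, t) ∈ C)
    (hy : 0 ≤ y) (hyt : y ≤ t) : (x, y) ∈ C := by
  have hx0 : (x, (0 : ℝ)) ∈ C := by
    rcases hx.eq_or_lt with rfl | hx
    · exact h0
    · have hWp : 0 < W := by linarith
      have := hC h0 hW (a := 1 - x / W) (b := x / W) (by rw [sub_nonneg, div_le_one hWp]; exact hxW)
        (by positivity) (by ring)
      convert this using 1
      ext <;> simp; field_simp
  rcases (hy.trans hyt).eq_or_lt with h | h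
  · have : y = t := by linarith
    rwa [this]
  · have := hC hx0 ht (a := 1 - y / t) (b := y / t) (by rw [sub_nonneg, div_le_one h]; exact hyt)
        (by positivity) (by ring)
    convert this using 1
    ext <;> simp
    · ring
    · field_simp

lemma chain (a b : ℝ) (ha : 0 < a) (hb : 0 < b) (S : Finset (ℝ × ℝ)) (W M : ℝ)
    (hnn : ∀ s ∈ S, 0 ≤ s.1 ∧ 0 ≤ s.2 ∧ s.1 ≤ W ∧ b * s.1 + a * s.2 ≤ M)
    (hW : (W, (0 : ℝ)) ∈ S) :
    ∀ (N : ℕ) (v : ℝ × ℝ) (μ : ℝ), v ∈ S → (S.filter (fun s => v.1 < s.1)).card = N → μ ≤ 0 →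
      (∀ s ∈ S, s.2 - v.2 ≤ μ * (s.1 - v.1)) →
      ∃ (m : ℕ) (u : ℕ → ℝ × ℝ), u 0 = v ∧ u m = (W, 0) ∧ (∀ i ≤ m, u i ∈ S) ∧
        (∀ i ≤ m, (u i).1 = W ∨ ∀ s ∈ S, s.1 = (u i).1 → s.2 ≤ (u i).2) ∧
        (∀ i < m, (u i).1 - (u i).2 < (u (i+1)).1 - (u (i+1)).2) ∧
        (∀ i < m, ∀ s ∈ S, det2 (u (i+1) - u i) (s - u i) ≤ 0) ∧
        (∀ i < m, 0 ≤ ecost a b (u i) (u (i+1))) ∧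
        (∑ i ∈ Finset.range m, ecost a b (u i) (u (i+1)) ≤ M - b * v.1) ∧
        (b ≤ -μ * a → ∑ i ∈ Finset.range m, ecost a b (u i) (u (i+1)) ≤ a * v.2) ∧
        (∀ C : Set (ℝ × ℝ), Convex ℝ C → ((0 : ℝ), (0 : ℝ)) ∈ C → (∀ i ≤ m, u i ∈ C) →
          ∀ s ∈ S, v.1 ≤ s.1 → s ∈ C) := by
  intro N
  induction N using Nat.strong_induction_on with
  | _ N ih =>
  intro v μ hv hN hμ hsup
  obtain ⟨hv1, hv2, hvW, hvM⟩ := hnn v hv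
  rcases (S.filter (fun s => v.1 < s.1)).eq_empty_or_nonempty with hE | hE
  · have hvW' : v.1 = W := by
      apply le_antisymm hvW
      by_contra! h
      have : (W, (0 : ℝ)) ∈ S.filter (fun s => v.1 < s.1) := by simp [hW, h]
      rw [hE] at this; simp at this
    rcases hv2.eq_or_lt with h0 | h0
    · have hvv : v = (W, 0) := Prod.ext hvW' h0.symm
      refine ⟨0, fun _ => v, rfl, hvv, by simpa using hv, fun i _ => Or.inl hvW', by simp, by simp, by simp,
        ?_, ?_, ?_⟩
      · simp; nlinarith
      · intro _; simp; nlinarith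
      · intro C hC h0 hu s hs hvs
        obtain ⟨hs1, hs2, hsW, -⟩ := hnn s hs
        have h1 : s.1 = v.1 := by linarith
        have h2 := hsup s hs
        rw [h1, sub_self, mul_zero] at h2
        have : s = v := Prod.ext h1 (by linarith)
        rw [this]; exact hu 0 le_rfl
    · have hcost : ecost a b v (W, 0) = a * v.2 := by
        simp [ecost, hvW']; positivity
      refine ⟨1, fun i => if i = 0 then v else (W, 0), by simp, by simp, ?_, ?_, ?_, ?_, ?_, ?_, ?_, ?_⟩
      · intro i _; by_cases h : i = 0 <;> simp [h, hv, hW]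
      · intro i _; left; by_cases h : i = 0 <;> simp [h, hvW']
      · intro i hi
        obtain rfl : i = 0 := by omega
        simp [hvW', h0]
      · intro i hi s hs
        obtain rfl : i = 0 := by omega
        obtain ⟨hs1, hs2, hsW, -⟩ := hnn s hs
        simp [hvW', det2]
        nlinarith
      · intro i hi
        obtain rfl : i = 0 := by omega
        simp [hcost]; positivity
      · simp [hcost]; linarith
      · simp [hcost]
      · intro C hC h0 hu s hs hvs
        obtain ⟨hs1, hs2, hsW, -⟩ := hnn s hs
        have h1 : s.1 = v.1 := by linarith
        have h2 := hsup s hs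
        rw [h1, sub_self, mul_zero] at h2
        have e0 := hu 0 (by simp)
        have e1 := hu 1 (by simp)
        simp at e0 e1
        exact conv_fill C hC h0 W e1 s.1 v.2 s.2 hs1 hsW (by rw [h1]; exact e0) hs2 (by linarith)
  · obtain ⟨t, ht, htmax⟩ := Finset.exists_max_image _ (fun s => (s.2 - v.2) / (s.1 - v.1)) hE
    rw [Finset.mem_filter] at ht
    obtain ⟨htS, hvt⟩ := ht
    have hp : 0 < t.1 - v.1 := by linarith
    set μ' := (t.2 - v.2) / (t.1 - v.1) with hμ'
    have hline : t.2 - v.2 = μ' * (t.1 - v.1) := by rw [hμ']; field_simp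
    have hμμ : μ' ≤ μ := by
      have := hsup t htS
      rw [hline] at this
      exact le_of_mul_le_mul_right this hp
    have hsup' : ∀ s ∈ S, s.2 - v.2 ≤ μ' * (s.1 - v.1) := by
      intro s hs
      by_cases h : v.1 < s.1
      · have := htmax s (by simp [hs, h])
        rwa [div_le_iff₀ (by linarith)] at this
      · have := hsup s hs
        nlinarith
    have hsupt : ∀ s ∈ S, s.2 - t.2 ≤ μ' * (s.1 - t.1) := by
      intro s hs
      have := hsup' s hs
      nlinarith
    have hcard : (S.filter (fun s => t.1 < s.1)).card < N := by
      rw [← hN]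
      apply Finset.card_lt_card
      rw [Finset.ssubset_iff_of_subset]
      · exact ⟨t, by simp [htS, hvt], by simp⟩
      · intro s hs
        simp only [Finset.mem_filter] at *
        exact ⟨hs.1, by linarith⟩
    have hμ0 : μ' ≤ 0 := hμμ.trans hμ
    obtain ⟨m, u, hu0, hum, huS, hutop, huinc, hudet, hcn, hc1, hc2, hfill⟩ :=
      ih _ hcard t μ' htS rfl hμ0 hsupt
    have hty : t.2 ≤ v.2 := by nlinarith
    have hsum : ∑ i ∈ Finset.range (m+1), ecost a b ((fun i => Nat.casesOn i v u : ℕ → ℝ × ℝ) i)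
        ((fun i => Nat.casesOn i v u : ℕ → ℝ × ℝ) (i+1)) =
        ∑ i ∈ Finset.range m, ecost a b (u i) (u (i+1)) + ecost a b v t := by
      rw [Finset.sum_range_succ']
      simp [hu0]
    refine ⟨m + 1, fun i => Nat.casesOn i v u, rfl, hum, ?_, ?_, ?_, ?_, ?_, ?_, ?_, ?_⟩
    · rintro (_ | i) hi
      · exact hv
      · exact huS i (by omega)
    · rintro (_ | i) hi
      · right
        intro s hs h1
        have := hsup s hs
        change s.1 = v.1 at h1
        rw [h1, sub_self, mul_zero] at this
        change s.2 ≤ v.2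
        linarith
      · exact hutop i (by omega)
    · rintro (_ | i) hi
      · change v.1 - v.2 < (u 0).1 - (u 0).2
        rw [hu0]; linarith
      · exact huinc i (by omega)
    · rintro (_ | i) hi
      · intro s hs
        have := hsup' s hs
        change det2 (u 0 - v) (s - v) ≤ 0
        simp only [hu0, det2, Prod.fst_sub, Prod.snd_sub]
        rw [hline]
        nlinarith
      · exact hudet i (by omega)
    · rintro (_ | i) hi
      · change 0 ≤ ecost a b v (u 0)
        rw [hu0]
        exact le_max_of_le_left (by positivity)
      · exact hcn i (by omega)
    · rw [hsum]
      by_cases hst : b ≤ -μ' * a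
      · have := hc2 hst
        have h2 : ecost a b v t ≤ a * (v.2 - t.2) := by
          apply max_le _ le_rfl
          have : v.2 - t.2 = -μ' * (t.1 - v.1) := by linarith
          rw [this]; nlinarith
        linarith
      · have h2 : ecost a b v t ≤ b * (t.1 - v.1) := by
          apply max_le le_rfl
          have : v.2 - t.2 = -μ' * (t.1 - v.1) := by linarith
          rw [this]; nlinarith
        linarith
    · intro hst0
      rw [hsum]
      have hst : b ≤ -μ' * a := by nlinarith
      have := hc2 hst
      have h2 : ecost a b v t ≤ a * (v.2 - t.2) := by
          apply max_le _ le_rfl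
          have : v.2 - t.2 = -μ' * (t.1 - v.1) := by linarith
          rw [this]; nlinarith
      linarith
    · intro C hC h0 hu s hs hvs
      by_cases hts : t.1 ≤ s.1
      · exact hfill C hC h0 (fun i hi => hu (i+1) (by omega)) s hs hts
      · push Not at hts
        obtain ⟨hs1, hs2, hsW, -⟩ := hnn s hs
        have e0 : v ∈ C := hu 0 (by omega)
        have e1 : t ∈ C := by have := hu 1 (by omega); simpa [hu0] using this
        have e2 : (W, (0 : ℝ)) ∈ C := by have := hu (m+1) (by omega); simpa [hum] using this
        refine conv_fill C hC h0 W e2 s.1 (v.2 + μ' * (s.1 - v.1)) s.2 hs1 hsW ?_ hs2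
          (by linarith [hsup' s hs])
        have := hC e0 e1 (a := 1 - (s.1 - v.1) / (t.1 - v.1)) (b := (s.1 - v.1) / (t.1 - v.1))
          (by rw [sub_nonneg, div_le_one hp]; linarith) (div_nonneg (by linarith) hp.le) (by ring)
        convert this using 1
        ext
        · simp; field_simp; ring
        · simp only [Prod.snd_add, Prod.smul_snd, smul_eq_mul]
          have ht2 : t.2 = v.2 + μ' * (t.1 - v.1) := by linarith
          rw [ht2]; field_simp; ring

lemma mkPoly (S : Finset (ℝ × ℝ)) (m : ℕ) (u : ℕ → ℝ × ℝ) (huS : ∀ i ≤ m, u i ∈ S)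
    (hinj : ∀ i j, i ≤ m → j ≤ m → u i = u j → i = j)
    (hdet : ∀ i < m, ∀ s ∈ S, det2 (u (i+1) - u i) (s - u i) ≤ 0)
    (hclose : ∀ s ∈ S, det2 (u 0 - u m) (s - u m) ≤ 0) :
    ∃ P : ClockPolygon, P.n = m + 1 ∧ (∀ i ≤ m, P.verts i = u i) ∧ (∀ i, P.verts i ∈ S) ∧
      P.verts (m+1) = u 0 := by
  have hlt : ∀ i, i % (m+1) < m + 1 := fun i => Nat.mod_lt _ (by omega)
  refine ⟨⟨m+1, by omega, fun i => u (i % (m+1)), ?_, ?_, ?_⟩, rfl, ?_, ?_, ?_⟩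
  · intro i; simp
  · intro i j hi hj h
    simp only [Nat.mod_eq_of_lt hi, Nat.mod_eq_of_lt hj] at h
    exact hinj i j (by omega) (by omega) h
  · intro i
    have key : ∀ s ∈ S, det2 (u ((i+1) % (m+1)) - u (i % (m+1))) (s - u (i % (m+1))) ≤ 0 := by
      have h := hlt i
      by_cases h2 : i % (m+1) = m
      · have : (i + 1) % (m+1) = 0 := by
          rw [Nat.add_mod, h2]
          rcases m with _ | m
          · simp [Nat.mod_one]
          · rw [Nat.mod_eq_of_lt (a := 1) (by omega)]; simp
        rw [this, h2]; exact hclose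
      · have : (i + 1) % (m+1) = i % (m+1) + 1 := by
          rw [Nat.add_mod]
          rcases m with _ | m
          · omega
          · rw [Nat.mod_eq_of_lt (a := 1) (by omega), Nat.mod_eq_of_lt (by omega)]
        rw [this]; exact hdet _ (by omega)
    set v := u (i % (m+1))
    set w := u ((i+1) % (m+1))
    have : convexHull ℝ (Set.range fun i => u (i % (m+1))) ⊆ {q | det2 (w - v) (q - v) ≤ 0} := by
      apply convexHull_min
      · rintro _ ⟨j, rfl⟩
        exact key _ (huS _ (by have := hlt j; omega))
      · intro p hp q hq s t hs ht hst
        simp only [Set.mem_ofPred_eq, det2, Prod.fst_add, Prod.snd_add, Prod.smul_fst, Prod.smul_snd,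
          Prod.fst_sub, Prod.snd_sub, smul_eq_mul] at *
        obtain rfl : t = 1 - s := by linarith
        nlinarith [mul_le_mul_of_nonneg_left hp hs, mul_le_mul_of_nonneg_left hq ht]
    exact this
  · intro i hi; simp only []; rw [Nat.mod_eq_of_lt (by omega)]
  · intro i; exact huS _ (by have := hlt i; omega)
  · simp

lemma poly_sum (Ω : Set (ℝ × ℝ)) (P : ClockPolygon) (m : ℕ) (u : ℕ → ℝ × ℝ) (hn : P.n = m + 1)
    (hu : ∀ i ≤ m, P.verts i = u i) (hu' : P.verts (m+1) = u 0) :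
    omegaPerim Ω P = ∑ i ∈ Finset.range m, omegaLen Ω (u (i+1) - u i) + omegaLen Ω (u 0 - u m) := by
  rw [omegaPerim, hn, Finset.sum_range_succ, hu', hu m le_rfl]
  congr 1
  apply Finset.sum_congr rfl
  intro i hi
  rw [Finset.mem_range] at hi
  rw [hu i (by omega), hu (i+1) (by omega)]

lemma upper (a b : ℝ) (ha : 0 < a) (hb : 0 < b) (S : Finset (ℝ × ℝ)) (W H M : ℝ)
    (hnn : ∀ s ∈ S, 0 ≤ s.1 ∧ 0 ≤ s.2 ∧ s.1 ≤ W ∧ b * s.1 + a * s.2 ≤ M)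
    (hW : (W, (0 : ℝ)) ∈ S) (hH : ((0 : ℝ), H) ∈ S) (h00 : ((0 : ℝ), (0 : ℝ)) ∈ S)
    (hSH : ∀ s ∈ S, s.2 ≤ H) :
    ∃ P : ClockPolygon, (∀ i, P.verts i ∈ S) ∧ P.body = convexHull ℝ (S : Set (ℝ × ℝ)) ∧
      omegaPerim (convexHull ℝ {((0 : ℝ), (0 : ℝ)), (a, 0), (0, b)}) P ≤ M := by
  obtain ⟨m, u, hu0, hum, huS, hutop, huinc, hudet, hcn, hc1, -, hfill⟩ :=
    chain a b ha hb S W M hnn hW _ (0, H) 0 hH rfl le_rfl (by intro s hs; simp; exact hSH s hs)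
  have hmono : ∀ d i, i + d + 1 ≤ m → (u i).1 - (u i).2 < (u (i+d+1)).1 - (u (i+d+1)).2 := by
    intro d
    induction d with
    | zero => intro i hi; exact huinc i (by omega)
    | succ d ih =>
      intro i hi
      exact (ih i (by omega)).trans (huinc (i+d+1) (by omega))
  have hinj : ∀ i j, i ≤ m → j ≤ m → u i = u j → i = j := by
    intro i j hi hj h
    rcases lt_trichotomy i j with hl | hl | hl
    · obtain ⟨d, rfl⟩ := Nat.exists_eq_add_of_lt hl
      have := hmono d i hj
      rw [h] at this; linarith
    · exact hl
    · obtain ⟨d, rfl⟩ := Nat.exists_eq_add_of_lt hl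
      have := hmono d j hi
      rw [h] at this; linarith
  set Ω := convexHull ℝ {((0 : ℝ), (0 : ℝ)), (a, 0), (0, b)} with hΩ
  have hW0 : 0 ≤ W := (hnn _ hW).1
  have hH0 : 0 ≤ H := (hnn _ hH).2.1
  have hlen : ∑ i ∈ Finset.range m, omegaLen Ω (u (i+1) - u i) ≤ M := by
    have : ∑ i ∈ Finset.range m, omegaLen Ω (u (i+1) - u i) ≤
        ∑ i ∈ Finset.range m, ecost a b (u i) (u (i+1)) := by
      apply Finset.sum_le_sum
      intro i hi
      rw [Finset.mem_range] at hi
      apply omegaLen_le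
      · exact hcn i hi
      · exact le_max_left _ _
      · refine le_trans (le_of_eq ?_) (le_max_right _ _)
        simp only [Prod.snd_sub]; ring
    simp only [mul_zero, sub_zero] at hc1
    linarith
  have hbody : ∀ P : ClockPolygon, (∀ i, P.verts i ∈ S) → ((0 : ℝ), (0 : ℝ)) ∈ P.body →
      (∀ i ≤ m, u i ∈ P.body) → P.body = convexHull ℝ (S : Set (ℝ × ℝ)) := by
    intro P h1 h2 h3
    apply Set.Subset.antisymm
    · apply convexHull_mono
      rintro _ ⟨i, rfl⟩; exact h1 i
    · apply convexHull_min _ (convex_convexHull _ _)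
      intro s hs
      exact hfill _ (convex_convexHull _ _) h2 h3 s hs (hnn s hs).1
  have hvb : ∀ P : ClockPolygon, ∀ i, P.verts i ∈ P.body := fun P i => subset_convexHull _ _ ⟨i, rfl⟩
  by_cases hdeg : W = 0 ∨ H = 0
  · obtain ⟨P, hn, hPu, hPS, hPc⟩ := mkPoly S m u huS hinj hudet (by
      intro s hs
      rw [hu0, hum]
      obtain ⟨h1, h2, h3, -⟩ := hnn s hs
      have h4 := hSH s hs
      simp only [det2, Prod.fst_sub, Prod.snd_sub]
      rcases hdeg with rfl | rfl
      · have : s.1 = 0 := by linarith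
        rw [this]; simp
      · have : s.2 = 0 := by linarith
        rw [this]; simp)
    refine ⟨P, hPS, hbody P hPS ?_ ?_, ?_⟩
    · rcases hdeg with rfl | rfl
      · rw [← hum, ← hPu m le_rfl]; exact hvb P m
      · rw [← hu0, ← hPu 0 (by omega)]; exact hvb P 0
    · intro i hi; rw [← hPu i hi]; exact hvb P i
    · rw [poly_sum Ω P m u hn hPu hPc]
      have : omegaLen Ω (u 0 - u m) ≤ 0 := by
        rw [hu0, hum]
        apply omegaLen_le <;> simp <;> positivity
      linarith
  · push Not at hdeg
    have hWp : 0 < W := lt_of_le_of_ne hW0 hdeg.1.symm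
    have hHp : 0 < H := lt_of_le_of_ne hH0 hdeg.2.symm
    have hne : ∀ i ≤ m, u i ≠ (0, 0) := by
      intro i hi h
      rcases hutop i hi with h1 | h1
      · rw [h] at h1; simp at h1; linarith
      · have := h1 _ hH (by rw [h])
        rw [h] at this; simp at this; linarith
    set u' : ℕ → ℝ × ℝ := fun i => Nat.casesOn i (0, 0) u with hu'
    obtain ⟨P, hn, hPu, hPS, hPc⟩ := mkPoly S (m+1) u' (by
        rintro (_ | i) hi
        · exact h00
        · exact huS i (by omega)) (by
        rintro (_ | i) (_ | j) hi hj h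
        · rfl
        · exact absurd h.symm (hne j (by omega))
        · exact absurd h (hne i (by omega))
        · rw [hinj i j (by omega) (by omega) h]) (by
        rintro (_ | i) hi s hs
        · obtain ⟨h1, h2, h3, -⟩ := hnn s hs
          simp [hu', hu0, det2]; positivity
        · exact hudet i (by omega) s hs) (by
        intro s hs
        obtain ⟨h1, h2, h3, -⟩ := hnn s hs
        simp [hu', hum, det2]; positivity)
    refine ⟨P, hPS, hbody P hPS ?_ ?_, ?_⟩
    · have := hPu 0 (by omega)
      change _ = ((0 : ℝ), (0 : ℝ)) at this
      rw [← this]; exact hvb P 0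
    · intro i hi
      have := hPu (i+1) (by omega)
      change _ = u i at this
      rw [← this]; exact hvb P _
    · rw [poly_sum Ω P (m+1) u' hn hPu hPc, Finset.sum_range_succ']
      have e1 : omegaLen Ω (u' 0 - u' (m+1)) ≤ 0 := by
        simp only [hu', hum]
        apply omegaLen_le <;> simp <;> positivity
      have e2 : omegaLen Ω (u' (0+1) - u' 0) ≤ 0 := by
        simp only [hu', hu0]
        apply omegaLen_le <;> simp <;> positivity
      change ∑ i ∈ Finset.range m, omegaLen Ω (u (i+1) - u i) + _ + _ ≤ M
      linarith

def kf (a b : ℝ) (p : ℕ × ℕ) : ℝ := b * p.1 + a * p.2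

def key (a b : ℝ) (p : ℕ × ℕ) : ℝ ×ₗ ℕ := toLex (kf a b p, p.1)

def rk (a b : ℝ) (p : ℕ × ℕ) : ℕ := {q : ℕ × ℕ | key a b q < key a b p}.ncard

def emb (p : ℕ × ℕ) : ℝ × ℝ := ((p.1 : ℝ), (p.2 : ℝ))

lemma emb_inj : Function.Injective emb := by
  intro p q h
  simp only [emb, Prod.mk.injEq, Nat.cast_inj] at h
  exact Prod.ext h.1 h.2

lemma kf_finite (a b : ℝ) (ha : 0 < a) (hb : 0 < b) (r : ℝ) : {q : ℕ × ℕ | kf a b q ≤ r}.Finite := by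
  apply Set.Finite.subset (Set.finite_Iic ((⌊r / b⌋₊, ⌊r / a⌋₊) : ℕ × ℕ))
  rintro ⟨x, y⟩ h
  have hx : (0 : ℝ) ≤ x := by positivity
  have hy : (0 : ℝ) ≤ y := by positivity
  have h : b * x + a * y ≤ r := h
  constructor
  · apply Nat.le_floor
    rw [le_div_iff₀ hb]
    nlinarith [mul_nonneg ha.le hy]
  · apply Nat.le_floor
    rw [le_div_iff₀ ha]
    nlinarith [mul_nonneg hb.le hx]

lemma key_le (a b : ℝ) (p q : ℕ × ℕ) :
    key a b p ≤ key a b q ↔ kf a b p < kf a b q ∨ (kf a b p = kf a b q ∧ p.1 ≤ q.1) := by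
  simp [key, Prod.Lex.toLex_le_toLex]

lemma kf_le_of_key (a b : ℝ) (p q : ℕ × ℕ) (h : key a b p ≤ key a b q) : kf a b p ≤ kf a b q := by
  rw [key_le] at h
  rcases h with h | h
  · exact h.le
  · exact h.1.le

lemma key_lt_of_kf (a b : ℝ) (p q : ℕ × ℕ) (h : kf a b p < kf a b q) : key a b p < key a b q := by
  by_contra! h'
  exact absurd (kf_le_of_key _ _ _ _ h') (not_le.mpr h)

lemma key_inj (a b : ℝ) (ha : 0 < a) : Function.Injective (key a b) := by
  intro p q h
  have : (kf a b p, p.1) = (kf a b q, q.1) := toLex.injective h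
  simp only [Prod.mk.injEq, kf] at this
  obtain ⟨h1, h2⟩ := this
  refine Prod.ext h2 ?_
  rw [h2] at h1
  have : a * (p.2 : ℝ) = a * q.2 := by linarith
  have := mul_left_cancel₀ ha.ne' this
  exact_mod_cast this

lemma key_finite (a b : ℝ) (ha : 0 < a) (hb : 0 < b) (p : ℕ × ℕ) :
    {q : ℕ × ℕ | key a b q ≤ key a b p}.Finite :=
  (kf_finite a b ha hb (kf a b p)).subset (fun q hq => kf_le_of_key _ _ _ _ hq)

lemma key_finite' (a b : ℝ) (ha : 0 < a) (hb : 0 < b) (p : ℕ × ℕ) :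
    {q : ℕ × ℕ | key a b q < key a b p}.Finite :=
  (key_finite a b ha hb p).subset (fun q (hq : key a b q < key a b p) => (le_of_lt hq : key a b q ≤ key a b p))

lemma rk_succ (a b : ℝ) (ha : 0 < a) (hb : 0 < b) (p : ℕ × ℕ) :
    {q : ℕ × ℕ | key a b q ≤ key a b p}.ncard = rk a b p + 1 := by
  have : {q : ℕ × ℕ | key a b q ≤ key a b p} = insert p {q : ℕ × ℕ | key a b q < key a b p} := by
    ext q
    simp only [Set.mem_ofPred_eq, Set.mem_insert_iff, le_iff_lt_or_eq, (key_inj a b ha).eq_iff]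
    tauto
  rw [this, Set.ncard_insert_of_notMem (by simp) (key_finite' a b ha hb p), rk]

lemma rk_lt (a b : ℝ) (ha : 0 < a) (hb : 0 < b) (p q : ℕ × ℕ) (h : key a b p < key a b q) :
    rk a b p < rk a b q := by
  have := Set.ncard_le_ncard (s := {x : ℕ × ℕ | key a b x ≤ key a b p})
    (t := {x : ℕ × ℕ | key a b x < key a b q}) (fun x hx => lt_of_le_of_lt hx h)
    (key_finite' a b ha hb q)
  rw [rk_succ a b ha hb] at this
  exact this

lemma rk_inj (a b : ℝ) (ha : 0 < a) (hb : 0 < b) : Function.Injective (rk a b) := by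
  intro p q h
  rcases lt_trichotomy (key a b p) (key a b q) with hl | hl | hl
  · exact absurd h (rk_lt a b ha hb _ _ hl).ne
  · exact key_inj a b ha hl
  · exact absurd h (rk_lt a b ha hb _ _ hl).ne'

lemma rk_surj (a b : ℝ) (ha : 0 < a) (hb : 0 < b) : Function.Surjective (rk a b) := by
  intro k
  have hfin := key_finite' a b ha hb (k + 1, 0)
  set F := hfin.toFinset with hF
  have hcard : F.card = rk a b (k+1, 0) := by
    rw [hF, ← Set.ncard_eq_toFinset_card _ hfin]; rfl
  have hk : k < F.card := by
    have : (Finset.range (k+1)).image (fun i => ((i, 0) : ℕ × ℕ)) ⊆ F := by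
      intro x hx
      simp only [Finset.mem_image, Finset.mem_range] at hx
      obtain ⟨i, hi, rfl⟩ := hx
      simp only [hF, Set.Finite.mem_toFinset, Set.mem_ofPred_eq]
      apply key_lt_of_kf
      simp only [kf]
      have : (i : ℝ) < ((k + 1 : ℕ) : ℝ) := by exact_mod_cast hi
      nlinarith
    have := Finset.card_le_card this
    rw [Finset.card_image_of_injective _ (by intro i j h; simpa using h), Finset.card_range] at this
    omega
  have := Finset.surjOn_of_injOn_of_card_le (s := F) (t := Finset.range F.card) (rk a b)
    (by
      intro x hx
      simp only [hF, Set.Finite.coe_toFinset, Set.mem_ofPred_eq] at hx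
      rw [Finset.coe_range, Set.mem_Iio, hcard]
      exact rk_lt a b ha hb _ _ hx)
    ((rk_inj a b ha hb).injOn) (by simp)
  obtain ⟨x, -, hx⟩ := this (by simpa using hk : k ∈ (Finset.range F.card : Set ℕ))
  exact ⟨x, hx⟩

lemma hull_rect (S : Set (ℝ × ℝ))
    (h1 : ∀ s ∈ S, (s.1, (0 : ℝ)) ∈ S) (h2 : ∀ s ∈ S, ((0 : ℝ), s.2) ∈ S) (h0 : ((0 : ℝ), (0 : ℝ)) ∈ S) :
    ∀ q ∈ convexHull ℝ S, Set.Icc (0 : ℝ) q.1 ×ˢ Set.Icc (0 : ℝ) q.2 ⊆ convexHull ℝ S := by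
  intro q hq
  set C := convexHull ℝ S with hCdef
  have hC : Convex ℝ C := convex_convexHull _ _
  have hz : ((0 : ℝ), (0 : ℝ)) ∈ C := subset_convexHull _ _ h0
  have p1 : (q.1, (0 : ℝ)) ∈ C := by
    have : C ⊆ {q | (q.1, (0 : ℝ)) ∈ C} := by
      apply convexHull_min
      · intro s hs; exact subset_convexHull _ _ (h1 s hs)
      · intro p hp q hq s t hs ht hst
        have := hC hp hq hs ht hst
        simpa using this
    exact this hq
  have p2 : ((0 : ℝ), q.2) ∈ C := by
    have : C ⊆ {q | ((0 : ℝ), q.2) ∈ C} := by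
      apply convexHull_min
      · intro s hs; exact subset_convexHull _ _ (h2 s hs)
      · intro p hp q hq s t hs ht hst
        have := hC hp hq hs ht hst
        simpa using this
    exact this hq
  rintro ⟨x, y⟩ ⟨⟨hx0, hx⟩, ⟨hy0, hy⟩⟩
  simp only at hx0 hx hy0 hy
  have hxq : (x, q.2) ∈ C := by
    rcases (hx0.trans hx).eq_or_lt with h | h
    · have : x = 0 := by linarith
      rw [this]; exact p2
    · have := hC p2 hq (a := 1 - x / q.1) (b := x / q.1) (by rw [sub_nonneg, div_le_one h]; exact hx)
        (by positivity) (by ring)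
      convert this using 1
      ext <;> simp
      · field_simp
      · ring
  exact conv_fill C hC hz q.1 p1 x q.2 y hx0 hx hxq hy0 hy

lemma echCap_rk (a b : ℝ) (ha : 0 < a) (hb : 0 < b) (p : ℕ × ℕ) :
    echCap (convexHull ℝ {((0 : ℝ), (0 : ℝ)), (a, 0), (0, b)}) (rk a b p) = kf a b p := by
  set Ω := convexHull ℝ {((0 : ℝ), (0 : ℝ)), (a, 0), (0, b)} with hΩ
  -- lower bound
  have hlow : ∀ P : ClockPolygon, IsCompetitor P → latticeCount P.body = rk a b p + 1 →
      kf a b p ≤ omegaPerim Ω P := by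
    intro P hP hc
    by_contra! hlt
    have hnn : P.body ⊆ {q | 0 ≤ q.1 ∧ 0 ≤ q.2} := by
      apply convexHull_min
      · rintro _ ⟨i, rfl⟩; exact hP.2.1 i
      · intro p hp q hq s t hs ht hst
        simp only [Set.mem_ofPred_eq, Prod.fst_add, Prod.snd_add, Prod.smul_fst, Prod.smul_snd, smul_eq_mul] at *
        obtain ⟨hp1, hp2⟩ := hp
        obtain ⟨hq1, hq2⟩ := hq
        constructor <;> positivity
    have hsub : {q ∈ P.body | IsLatticePt q} ⊆ emb '' {q : ℕ × ℕ | key a b q < key a b p} := by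
      rintro ⟨x, y⟩ ⟨hq, ⟨m, hm⟩, ⟨n, hn⟩⟩
      obtain ⟨hx, hy⟩ := hnn hq
      simp only at hm hn hx hy
      subst hm hn
      have hx' : 0 ≤ m := by exact_mod_cast hx
      have hy' : 0 ≤ n := by exact_mod_cast hy
      lift m to ℕ using hx'
      lift n to ℕ using hy'
      refine ⟨(m, n), ?_, by simp [emb]⟩
      apply key_lt_of_kf
      have := lower a b P hP _ hq
      refine lt_of_le_of_lt ?_ hlt
      simpa [kf] using this
    have := Set.ncard_le_ncard hsub ((key_finite' a b ha hb p).image _)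
    rw [Set.ncard_image_of_injective _ emb_inj] at this
    change latticeCount P.body ≤ rk a b p at this
    omega
  -- construction
  have hfin := key_finite a b ha hb p
  set T := hfin.toFinset with hT
  have hTm : ∀ q, q ∈ T ↔ key a b q ≤ key a b p := by intro q; simp [hT]
  have hdown : ∀ q q' : ℕ × ℕ, q ∈ T → q'.1 ≤ q.1 → q'.2 ≤ q.2 → q' ∈ T := by
    intro q q' hq h1 h2
    rw [hTm] at *
    refine le_trans ?_ hq
    rw [key_le]
    have h1' : (q'.1 : ℝ) ≤ q.1 := by exact_mod_cast h1
    have h2' : (q'.2 : ℝ) ≤ q.2 := by exact_mod_cast h2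
    have : kf a b q' ≤ kf a b q := by simp only [kf]; gcongr
    rcases this.lt_or_eq with h | h
    · exact Or.inl h
    · exact Or.inr ⟨h, h1⟩
  have hpT : p ∈ T := by rw [hTm]
  obtain ⟨w, hwT, hw⟩ := T.exists_max_image (fun q => q.1) ⟨p, hpT⟩
  obtain ⟨h, hhT, hh⟩ := T.exists_max_image (fun q => q.2) ⟨p, hpT⟩
  set S := T.image emb with hS
  have hmem : ∀ q ∈ T, emb q ∈ S := fun q hq => Finset.mem_image_of_mem _ hq
  have h00 : ((0 : ℝ), (0 : ℝ)) ∈ S := by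
    have := hmem (0, 0) (hdown p _ hpT (by simp) (by simp))
    simpa [emb] using this
  obtain ⟨P, hPS, hPb, hPp⟩ := upper a b ha hb S (w.1 : ℝ) (h.2 : ℝ) (kf a b p) (by
      intro s hs
      obtain ⟨q, hq, rfl⟩ := Finset.mem_image.mp hs
      refine ⟨by simp [emb], by simp [emb], by simpa [emb] using hw q hq, ?_⟩
      exact kf_le_of_key a b q p ((hTm q).mp hq)) (by
      have := hmem (w.1, 0) (hdown w _ hwT (by simp) (by simp))
      simpa [emb] using this) (by
      have := hmem (0, h.2) (hdown h _ hhT (by simp) (by simp))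
      simpa [emb] using this) h00 (by
      intro s hs
      obtain ⟨q, hq, rfl⟩ := Finset.mem_image.mp hs
      simpa [emb] using hh q hq)
  have hcomp : IsCompetitor P := by
    refine ⟨?_, ?_, ?_, ?_⟩
    · intro i
      obtain ⟨q, hq, hqe⟩ := Finset.mem_image.mp (hPS i)
      rw [← hqe]
      exact ⟨⟨q.1, by simp [emb]⟩, ⟨q.2, by simp [emb]⟩⟩
    · intro i
      obtain ⟨q, hq, hqe⟩ := Finset.mem_image.mp (hPS i)
      rw [← hqe]
      simp [emb]
    · rw [hPb]; exact subset_convexHull _ _ h00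
    · rw [hPb]
      apply hull_rect
      · intro s hs
        obtain ⟨q, hq, rfl⟩ := Finset.mem_image.mp hs
        have := hmem (q.1, 0) (hdown q _ hq (by simp) (by simp))
        simpa [emb] using this
      · intro s hs
        obtain ⟨q, hq, rfl⟩ := Finset.mem_image.mp hs
        have := hmem (0, q.2) (hdown q _ hq (by simp) (by simp))
        simpa [emb] using this
      · exact h00
  have hcount : latticeCount P.body = rk a b p + 1 := by
    rw [← rk_succ a b ha hb, ← Set.ncard_image_of_injective _ emb_inj, latticeCount]
    congr 1
    rw [hPb]
    apply Set.Subset.antisymm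
    · have hK : convexHull ℝ (S : Set (ℝ × ℝ)) ⊆ {q | 0 ≤ q.1 ∧ 0 ≤ q.2 ∧
          (b * q.1 + a * q.2 < kf a b p ∨ (b * q.1 + a * q.2 = kf a b p ∧ q.1 ≤ p.1))} := by
        apply convexHull_min
        · intro s hs
          obtain ⟨q, hq, rfl⟩ := Finset.mem_image.mp hs
          refine ⟨by simp [emb], by simp [emb], ?_⟩
          rw [hTm, key_le] at hq
          simpa [emb, kf] using hq
        · rintro ⟨x, y⟩ ⟨hx, hy, h1⟩ ⟨x', y'⟩ ⟨hx', hy', h2⟩ s t hs ht hst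
          simp only [Set.mem_ofPred_eq, Prod.fst_add, Prod.snd_add, Prod.smul_fst, Prod.smul_snd, smul_eq_mul] at *
          refine ⟨by positivity, by positivity, ?_⟩
          rcases hs.eq_or_lt with rfl | hs'
          · obtain rfl : t = 1 := by linarith
            simpa using h2
          rcases ht.eq_or_lt with rfl | ht'
          · obtain rfl : s = 1 := by linarith
            simpa using h1
          obtain rfl : t = 1 - s := by linarith
          generalize kf a b p = c at *
          rcases h1 with h1 | ⟨h1, h1'⟩
          · left
            have h2' : b * x' + a * y' ≤ c := by
              rcases h2 with h | h
              · exact h.le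
              · exact h.1.le
            nlinarith [mul_lt_mul_of_pos_left h1 hs', mul_le_mul_of_nonneg_left h2' ht]
          · rcases h2 with h2 | ⟨h2, h2'⟩
            · left
              nlinarith [mul_lt_mul_of_pos_left h2 ht']
            · right
              constructor
              · rw [← h1] at h2 ⊢
                linear_combination (1 - s) * h2
              · nlinarith [mul_le_mul_of_nonneg_left h1' hs, mul_le_mul_of_nonneg_left h2' ht]
      rintro ⟨x, y⟩ ⟨hq, ⟨m, hm⟩, ⟨n, hn⟩⟩
      obtain ⟨hx, hy, hl⟩ := hK hq
      simp only at hm hn hx hy hl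
      subst hm hn
      have hx' : 0 ≤ m := by exact_mod_cast hx
      have hy' : 0 ≤ n := by exact_mod_cast hy
      lift m to ℕ using hx'
      lift n to ℕ using hy'
      refine ⟨(m, n), ?_, by simp [emb]⟩
      change key a b (m, n) ≤ key a b p
      rw [key_le]
      simpa [kf] using hl
    · rintro _ ⟨q, hq, rfl⟩
      refine ⟨subset_convexHull _ _ (hmem q ((hTm q).mpr hq)), ⟨q.1, by simp [emb]⟩, ⟨q.2, by simp [emb]⟩⟩
  apply le_antisymm
  · refine le_trans (csInf_le ⟨kf a b p, ?_⟩ ⟨P, hcomp, hcount, rfl⟩) hPp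
    rintro _ ⟨Q, h1, h2, rfl⟩
    exact hlow Q h1 h2
  · refine le_csInf (Set.nonempty_of_mem (x := omegaPerim Ω P) ⟨P, hcomp, hcount, rfl⟩) ?_
    rintro _ ⟨Q, h1, h2, rfl⟩
    exact hlow Q h1 h2

/-- The cap function of the ellipsoid `E(a,b)` (with
`Ω = conv{(0,0),(a,0),(0,b)}`) is the lattice-point counting function
`#{(m,n) ∈ ℤ≥0² : am + bn ≤ r}`. -/
theorem capFn_ellipsoid (a b : ℝ) (ha : 0 < a) (hb : 0 < b) :
    ∀ r : ℝ, 0 ≤ r →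
      capFn (convexHull ℝ {((0 : ℝ), (0 : ℝ)), (a, 0), (0, b)}) r =
        {p : ℕ × ℕ | a * p.1 + b * p.2 ≤ r}.ncard := by
  intro r _
  have h : {k : ℕ | echCap (convexHull ℝ {((0 : ℝ), (0 : ℝ)), (a, 0), (0, b)}) k ≤ r} =
      (fun p : ℕ × ℕ => rk a b p.swap) '' {p : ℕ × ℕ | a * p.1 + b * p.2 ≤ r} := by
    ext k
    constructor
    · intro hk
      obtain ⟨p, rfl⟩ := rk_surj a b ha hb k
      refine ⟨p.swap, ?_, by simp⟩
      have hk : echCap _ _ ≤ r := hk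
      rw [echCap_rk a b ha hb, kf] at hk
      simp only [Set.mem_ofPred_eq, Prod.fst_swap, Prod.snd_swap]
      linarith
    · rintro ⟨p, hp, rfl⟩
      have hp : a * p.1 + b * p.2 ≤ r := hp
      change echCap _ _ ≤ r
      rw [echCap_rk a b ha hb, kf]
      simp only [Prod.fst_swap, Prod.snd_swap]
      linarith
  rw [capFn, h, Set.ncard_image_of_injective]
  exact (rk_inj a b ha hb).comp Prod.swap_injective

end
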